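/- Let L be a frame. The following are equivalent: (i) L is ⊥-scattered, i.e. ⨅ᵢ aᵢ** ≤ (⨅ᵢ aᵢ)** for every indexed family {aᵢ} in L; (ii) (⨅ᵢ aᵢ)* ≤ (⨆ᵢ aᵢ*)** for every indexed family {aᵢ} in L; (iii) for every indexed family {aᵢ} in L with ⨅ᵢ aᵢ = ⊥ one has ⨅ᵢ aᵢ** = ⊥. -/

import Mathlib

universe u

/-- Pseudocomplementation in a frame turns suprema into infima. -/
theorem compl_iSup_eq_iInf_compl {L : Type*} [Order.Frame L] {ι : Sort*} (a : ι → L) :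
    (⨆ i, a i)ᶜ = ⨅ i, (a i)ᶜ :=
  eq_of_forall_le_iff fun b => by
    simp only [le_iInf_iff, le_compl_iff_disjoint_right, disjoint_iSup_iff]

/-- Characterizations of `⊥`-scattered frames. -/
theorem botScattered_tfae {L : Type u} [Order.Frame L] :
    List.TFAE
      [ ∀ {ι : Type u} (a : ι → L), (⨅ i, (a i)ᶜᶜ) ≤ (⨅ i, a i)ᶜᶜ,
        ∀ {ι : Type u} (a : ι → L), (⨅ i, a i)ᶜ ≤ (⨆ i, (a i)ᶜ)ᶜᶜ,
        ∀ {ι : Type u} (a : ι → L), (⨅ i, a i) = ⊥ → (⨅ i, (a i)ᶜᶜ) = ⊥ ] := by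
  simp only [compl_iSup_eq_iInf_compl]
  tfae_have 1 → 2 := fun h ι a => le_compl_comm.mp (h a)
  tfae_have 2 → 3 := fun h ι a ha => by
    have h_top := h a
    rwa [ha, compl_bot, le_compl_iff_disjoint_right, top_disjoint] at h_top
  tfae_have 3 → 1 := fun h ι a => by
    have h_bot := h (fun o : Option ι => o.elim (⨅ i, a i)ᶜ a)
      (by simp [iInf_option])
    simp only [iInf_option, Option.elim, compl_compl_compl] at h_bot
    exact le_compl_iff_disjoint_left.mpr (disjoint_iff.mpr h_bot)
  tfae_finish
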